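/- The CVaR–Bellman operator T̄ is a γ-contraction with respect to the sup-norm: for all functions v₁, v₂ : S × ℝ → ℝ and every real C ≥ 0 such that |v₁(s,z) − v₂(s,z)| ≤ C for all (s,z) ∈ S × ℝ, one has |T̄ v₁(s,z) − T̄ v₂(s,z)| ≤ γ·C for all (s,z) ∈ S × ℝ. -/

import Mathlib

/-- The CVaR–Bellman operator:
`T̄ v (s, z) = max_{a ∈ A} [min 0 (r s a + z) - min 0 z
  + γ * Σ_{s'} P(s'|s,a) * v (s', (r s a + z) / γ)]`. -/
noncomputable def cvarBellman {S A : Type*} [Fintype S] [Fintype A] [Nonempty A]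
    (P : S → A → PMF S) (r : S → A → ℝ) (γ : ℝ) (v : S × ℝ → ℝ) : S × ℝ → ℝ :=
  fun x => Finset.univ.sup' Finset.univ_nonempty fun a =>
    min 0 (r x.1 a + x.2) - min 0 x.2
      + γ * ∑ s' : S, ((P x.1 a) s').toReal * v (s', (r x.1 a + x.2) / γ)

/-- The probabilities of a `PMF` on a finite type, as real numbers, sum to one. -/
theorem PMF.sum_toReal_eq_one {S : Type*} [Fintype S] (p : PMF S) :
    ∑ s, (p s).toReal = 1 := by
  rw [← ENNReal.toReal_sum fun s _ => p.apply_ne_top s, ← tsum_fintype (L := .unconditional S),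
    p.tsum_coe, ENNReal.toReal_one]

/-- One-sided form of the contraction estimate. -/
theorem cvarBellman_le_add {S A : Type*} [Fintype S] [Fintype A] [Nonempty A]
    (P : S → A → PMF S) (r : S → A → ℝ) {γ : ℝ} (hγ : 0 ≤ γ) {v w : S × ℝ → ℝ} {C : ℝ}
    (h : ∀ x, v x ≤ w x + C) (x : S × ℝ) :
    cvarBellman P r γ v x ≤ cvarBellman P r γ w x + γ * C := by
  refine Finset.sup'_le _ _ fun a ha => ?_
  have hsum : ∑ s', ((P x.1 a) s').toReal * v (s', (r x.1 a + x.2) / γ) ≤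
      ∑ s', ((P x.1 a) s').toReal * w (s', (r x.1 a + x.2) / γ) + C := by
    calc ∑ s', ((P x.1 a) s').toReal * v (s', (r x.1 a + x.2) / γ)
        ≤ ∑ s', ((P x.1 a) s').toReal * (w (s', (r x.1 a + x.2) / γ) + C) := by
          gcongr
          exact h _
      _ = _ := by
          simp_rw [mul_add, Finset.sum_add_distrib, ← Finset.sum_mul, PMF.sum_toReal_eq_one,
            one_mul]
  have hsup : _ ≤ cvarBellman P r γ w x := Finset.le_sup' (fun a =>
    min 0 (r x.1 a + x.2) - min 0 x.2
      + γ * ∑ s' : S, ((P x.1 a) s').toReal * w (s', (r x.1 a + x.2) / γ)) ha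
  linarith [mul_le_mul_of_nonneg_left hsum hγ]

/-- the CVaR–Bellman operator is a `γ`-contraction in sup-norm. -/
theorem cvarBellman_contraction {S A : Type*} [Fintype S] [Nonempty S] [Fintype A] [Nonempty A]
    (P : S → A → PMF S) (r : S → A → ℝ) (r_max : ℝ) (hr_max : 0 < r_max)
    (hr : ∀ s a, |r s a| ≤ r_max) (γ : ℝ) (hγ : γ ∈ Set.Ioo (0 : ℝ) 1)
    (v₁ v₂ : S × ℝ → ℝ) (C : ℝ) (hC : 0 ≤ C)
    (h : ∀ s z, |v₁ (s, z) - v₂ (s, z)| ≤ C) :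
    ∀ s z, |cvarBellman P r γ v₁ (s, z) - cvarBellman P r γ v₂ (s, z)| ≤ γ * C := by
  intro s z
  have h₁₂ := cvarBellman_le_add P r hγ.1.le (v := v₁) (w := v₂) (C := C)
    (fun x => by linarith [(abs_le.mp (h x.1 x.2)).2]) (s, z)
  have h₂₁ := cvarBellman_le_add P r hγ.1.le (v := v₂) (w := v₁) (C := C)
    (fun x => by linarith [(abs_le.mp (h x.1 x.2)).1]) (s, z)
  exact abs_le.mpr ⟨by linarith, by linarith⟩
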